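/- arXiv:1303.0815 — 5 statements merged into one kernel-verified Lean document; each statement's English description precedes it below -/
import Mathlib

section
/- Let I be a set and P a family of filters on I, and let (X_j)_{j∈J} be a family of nonempty topological spaces. Then the product space ∏_{j∈J} X_j is sequencewise P-compact if and only if for every subset K ⊆ J of cardinality at most |P|, the subproduct ∏_{j∈K} X_j is sequencewise P-compact. -/
universe u v w

/-- A sequence `x : I → X` `F`-converges to `p` if for every open neighborhood `U` of `p`,
the set `{i | x i ∈ U}` belongs to `F`. -/
def FLimit {I : Type u} {X : Type v} [TopologicalSpace X] (F : Filter I)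
    (x : I → X) (p : X) : Prop :=
  ∀ U : Set X, IsOpen U → p ∈ U → {i | x i ∈ U} ∈ F

/-- A space `X` is sequencewise `P`-compact if every `I`-indexed sequence in `X`
has an `F`-limit point for some `F ∈ P`. -/
def SeqwisePCompact {I : Type u} (P : Set (Filter I)) (X : Type v)
    [TopologicalSpace X] : Prop :=
  ∀ x : I → X, ∃ F ∈ P, ∃ p : X, FLimit F x p

theorem fLimit_iff_tendsto {I : Type u} {X : Type v} [TopologicalSpace X] {F : Filter I}
    {x : I → X} {p : X} : FLimit F x p ↔ Filter.Tendsto x F (nhds p) := by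
  rw [tendsto_nhds]
  rfl

theorem FLimit.comp_continuous {I : Type u} {X : Type v} {Y : Type w} [TopologicalSpace X]
    [TopologicalSpace Y] {F : Filter I} {x : I → X} {p : X} (h : FLimit F x p) {f : X → Y}
    (hf : Continuous f) : FLimit F (fun i => f (x i)) (f p) :=
  fun U hU hp => h (f ⁻¹' U) (hU.preimage hf) hp

/-- Sequencewise `P`-compactness passes to continuous images. -/
theorem SeqwisePCompact.of_surjective {I : Type u} {P : Set (Filter I)} {X : Type v}
    {Y : Type w} [TopologicalSpace X] [TopologicalSpace Y] (h : SeqwisePCompact P X)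
    {f : X → Y} (hf : Continuous f) (hs : Function.Surjective f) : SeqwisePCompact P Y := by
  intro y
  choose g hg using hs
  obtain ⟨F, hF, p, hp⟩ := h fun i => g (y i)
  exact ⟨F, hF, f p, by simpa only [hg] using hp.comp_continuous hf⟩

theorem exists_fLimit_pi_iff {I : Type u} {J : Type v} {X : J → Type w}
    [∀ j, TopologicalSpace (X j)] {F : Filter I} {x : I → Π j, X j} :
    (∃ p, FLimit F x p) ↔ ∀ j, ∃ p, FLimit F (fun i => x i j) p := by
  simp only [fLimit_iff_tendsto, tendsto_pi_nhds]
  exact ⟨fun ⟨p, hp⟩ j => ⟨p j, hp j⟩, fun h => ⟨fun j => (h j).choose, fun j => (h j).choose_spec⟩⟩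

/-- A product of nonempty topological spaces is sequencewise `P`-compact iff so is
every subproduct with at most `|P|` factors. -/
theorem seqwisePCompact_pi_iff {I : Type u} {J : Type v} (P : Set (Filter I))
    (X : J → Type w) [∀ j, TopologicalSpace (X j)] [∀ j, Nonempty (X j)] :
    SeqwisePCompact P (Π j, X j) ↔
      ∀ K : Set J, Cardinal.lift.{u} (Cardinal.mk K) ≤ Cardinal.lift.{v} (Cardinal.mk P) →
        SeqwisePCompact P (Π j : K, X j) := by
  constructor
  · intro h K _
    exact h.of_surjective (Pi.continuous_domRestrict K) (Subtype.surjective_restrict (· ∈ K))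
  · intro h x
    by_contra! hx
    have hcoord (F : P) : ∃ j, ¬ ∃ p, FLimit F.1 (fun i => x i j) p := by
      by_contra! hF
      obtain ⟨p, hp⟩ := exists_fLimit_pi_iff.2 hF
      exact hx F F.2 p hp
    choose k hk using hcoord
    obtain ⟨F, hF, p, hp⟩ := h (Set.range k) Cardinal.mk_range_le_lift fun i j => x i j
    exact hk ⟨F, hF⟩ (exists_fLimit_pi_iff.1 ⟨p, hp⟩ ⟨k ⟨F, hF⟩, Set.mem_range_self _⟩)
end

section
/- Let μ ≤ ν be infinite cardinals and let λ be an infinite cardinal with 2^(ν^{<μ}) ≤ λ. If X₁ is a [μ,ν]-compact topological space and X₂ is an initially λ-compact topological space, then the product X₁ × X₂ is [μ,ν]-compact. -/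
universe u

/-- `X` is `[μ, ν]`-compact if every open cover of `X` of cardinality at most `ν`
has a subcover of cardinality strictly less than `μ`. -/
def IntervalCompact (μ ν : Cardinal.{u}) (X : Type u) [TopologicalSpace X] : Prop :=
  ∀ 𝒰 : Set (Set X), (∀ U ∈ 𝒰, IsOpen U) → ⋃₀ 𝒰 = Set.univ → Cardinal.mk 𝒰 ≤ ν →
    ∃ 𝒱 ⊆ 𝒰, Cardinal.mk 𝒱 < μ ∧ ⋃₀ 𝒱 = Set.univ

/-- `X` is initially `λ`-compact if every open cover of `X` of cardinality at most `λ`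
has a finite subcover. -/
def InitiallyCompact (lam : Cardinal.{u}) (X : Type u) [TopologicalSpace X] : Prop :=
  ∀ 𝒰 : Set (Set X), (∀ U ∈ 𝒰, IsOpen U) → ⋃₀ 𝒰 = Set.univ → Cardinal.mk 𝒰 ≤ lam →
    ∃ 𝒱 ⊆ 𝒰, 𝒱.Finite ∧ ⋃₀ 𝒱 = Set.univ

open Cardinal Filter Topology

theorem InitiallyCompact.intervalCompact {lam : Cardinal.{u}} {X : Type u} [TopologicalSpace X]
    (h : InitiallyCompact lam X) : IntervalCompact ℵ₀ lam X := by
  intro 𝒰 hopen hcover hcard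
  obtain ⟨𝒱, hsub, hfin, hV⟩ := h 𝒰 hopen hcover hcard
  exact ⟨𝒱, hsub, lt_aleph0_iff_set_finite.2 hfin, hV⟩

/-- In a `[μ, ν]`-compact space, a family of at most `ν` closed sets has nonempty intersection
as soon as each of its subfamilies of size less than `μ` does. -/
theorem IntervalCompact.nonempty_iInter {μ ν : Cardinal.{u}} {X : Type u} [TopologicalSpace X]
    (h : IntervalCompact μ ν X) {κ : Type u} (hκ : #κ ≤ ν) {C : κ → Set X}
    (hC : ∀ k, IsClosed (C k))
    (hJ : ∀ J : Set κ, #J < μ → (⋂ j ∈ J, C j).Nonempty) : (⋂ k, C k).Nonempty := by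
  by_contra hne
  rw [Set.not_nonempty_iff_eq_empty] at hne
  obtain ⟨𝒱, hsub, hlt, hV⟩ := h (Set.range fun k => (C k)ᶜ)
    (by rintro _ ⟨k, rfl⟩; exact (hC k).isOpen_compl)
    (by rw [Set.sUnion_range, ← Set.compl_iInter, hne, Set.compl_empty])
    (mk_range_le.trans hκ)
  choose f hf using fun V : 𝒱 => hsub V.2
  obtain ⟨x, hx⟩ := hJ (Set.range f) (mk_range_le.trans_lt hlt)
  obtain ⟨V, hV𝒱, hxV⟩ := hV.symm ▸ Set.mem_univ x
  have hxC := Set.mem_iInter₂.1 hx _ ⟨⟨V, hV𝒱⟩, rfl⟩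
  exact (hf ⟨V, hV𝒱⟩).ge hxV hxC

/-- In a `[μ, ν]`-compact space, a filter with a basis of at most `ν` sets, any fewer than `μ` of
which have a common point, has a cluster point. -/
theorem IntervalCompact.exists_clusterPt {μ ν : Cardinal.{u}} {X : Type u} [TopologicalSpace X]
    (h : IntervalCompact μ ν X) {κ : Type u} (hκ : #κ ≤ ν) {F : Filter X} {s : κ → Set X}
    (hF : F.HasBasis (fun _ => True) s)
    (hs : ∀ J : Set κ, #J < μ → (⋂ j ∈ J, s j).Nonempty) : ∃ y, ClusterPt y F := by
  obtain ⟨y, hy⟩ := h.nonempty_iInter hκ (C := fun k => closure (s k)) (fun _ => isClosed_closure)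
    fun J hJ => (hs J hJ).mono (Set.iInter₂_mono fun _ _ => subset_closure)
  refine ⟨y, hF.clusterPt_iff_forall_mem_closure.2 fun k _ => Set.mem_iInter.1 hy k⟩

/-- An initially `λ`-compact space is closed under limits along ultrafilters on index sets `I`
with `2 ^ #I ≤ λ`. -/
theorem InitiallyCompact.exists_tendsto {lam : Cardinal.{u}} {X : Type u} [TopologicalSpace X]
    (h : InitiallyCompact lam X) {I : Type u} (hI : 2 ^ #I ≤ lam) (D : Ultrafilter I)
    (f : I → X) : ∃ y, Tendsto f D (𝓝 y) := by
  obtain ⟨y, hy⟩ := h.intervalCompact.exists_clusterPt (κ := {A : Set I // A ∈ D})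
    (F := D.map f) (s := fun A => f '' A.1)
    ((mk_subtype_le _).trans (mk_set.trans_le hI))
    ⟨fun t => ⟨fun ht => ⟨⟨f ⁻¹' t, ht⟩, trivial, Set.image_preimage_subset f t⟩,
      fun ⟨A, _, hA⟩ => mem_of_superset (f := (D : Filter I)) A.2 (Set.image_subset_iff.1 hA)⟩⟩
    (by
      intro J hJ
      have hmem : (⋂ A ∈ J, A.1) ∈ (D : Filter I) :=
        (biInter_mem (lt_aleph0_iff_set_finite.1 hJ)).2 fun A _ => A.2
      obtain ⟨i, hi⟩ := D.nonempty_of_mem hmem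
      exact ⟨f i, Set.mem_iInter₂.2 fun A hA => ⟨i, Set.mem_iInter₂.1 hi A hA, rfl⟩⟩)
  exact ⟨y, Ultrafilter.clusterPt_iff.1 hy⟩

theorem mk_biUnion_finset_lt {μ : Cardinal.{u}} (hμ : ℵ₀ ≤ μ) {ι : Type u} {J : Set (Finset ι)}
    (hJ : #J < μ) : #(⋃ F ∈ J, (F : Set ι)) < μ := by
  rcases hμ.eq_or_lt with rfl | hμ
  · exact lt_aleph0_iff_set_finite.2
      ((lt_aleph0_iff_set_finite.1 hJ).biUnion fun F _ => F.finite_toSet)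
  · refine (mk_biUnion_le _ J).trans_lt (mul_lt_of_lt hμ.le hJ ((ciSup_le' fun F => ?_).trans_lt hμ))
    exact (finset_card_lt_aleph0 F.1).le

theorem mk_finset_le {ν : Cardinal.{u}} (hν : ℵ₀ ≤ ν) {ι : Type u} (hι : #ι ≤ ν) :
    #(Finset ι) ≤ ν := by
  classical
  exact (mk_le_of_surjective List.toFinset_surjective).trans
    ((mk_list_le_max ι).trans (max_le hν hι))

/-- A set of size at most `ν` has at most `ν^{<μ}` subsets of size less than `μ`. -/
theorem mk_subsets_lt_le_powerlt {μ ν : Cardinal.{u}} (hμ : ℵ₀ ≤ μ) (hμν : μ ≤ ν) {ι : Type u}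
    (hι : #ι ≤ ν) : #{Z : Set ι // #Z < μ} ≤ ν ^< μ := by
  have hle : ν ≤ ν ^< μ := by
    simpa using le_powerlt ν (one_lt_aleph0.trans_le hμ)
  have hfib := mk_le_mk_mul_of_mk_preimage_le (c := ν ^< μ)
    (fun Z : {Z : Set ι // #Z < μ} => Ordinal.ToType.mk ⟨(#Z.1).ord, ord_lt_ord.2 Z.2⟩) ?_
  · rw [mk_ord_toType] at hfib
    exact hfib.trans (mul_le_of_le ((hμ.trans hμν).trans hle) (hμν.trans hle) le_rfl)
  · intro b
    rcases Set.eq_empty_or_nonempty ((fun Z : {Z : Set ι // #Z < μ} =>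
      Ordinal.ToType.mk (o := μ.ord) ⟨(#Z.1).ord, ord_lt_ord.2 Z.2⟩) ⁻¹' {b}) with he | ⟨Z₀, hZ₀⟩
    · rw [he]; simp
    · have hcard : ∀ Z ∈ (fun Z : {Z : Set ι // #Z < μ} =>
          Ordinal.ToType.mk (o := μ.ord) ⟨(#Z.1).ord, ord_lt_ord.2 Z.2⟩) ⁻¹' {b},
          #Z.1 ≤ #Z₀.1 := by
        intro Z hZ
        have := Ordinal.ToType.mk.injective ((Set.mem_singleton_iff.1 hZ).trans
          (Set.mem_singleton_iff.1 hZ₀).symm)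
        exact (ord_injective (congrArg Subtype.val this)).le
      refine (mk_le_of_injective (β := {t : Set ι // #t ≤ #Z₀.1})
        (f := fun Z => ⟨Z.1.1, hcard Z.1 Z.2⟩) ?_).trans ?_
      · intro Z Z' hZZ'
        exact Subtype.ext (Subtype.ext (Subtype.mk.inj hZZ'))
      · exact (mk_bounded_set_le ι _).trans
          ((power_le_power_right (max_le hι (hμ.trans hμν))).trans (le_powerlt ν Z₀.2))

/-- In a `[μ, ν]`-compact space, every family of points indexed by the subsets of `ι` of size less
than `μ`, where `#ι ≤ ν`, converges along some ultrafilter containing all the sets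
`{Z | a ∈ Z}`. -/
theorem IntervalCompact.exists_ultrafilter_tendsto {μ ν : Cardinal.{u}} (hμ : ℵ₀ ≤ μ)
    (hμν : μ ≤ ν) {X : Type u} [TopologicalSpace X] (h : IntervalCompact μ ν X) {ι : Type u}
    (hι : #ι ≤ ν) (f : {Z : Set ι // #Z < μ} → X) :
    ∃ D : Ultrafilter {Z : Set ι // #Z < μ},
      (∀ a, ∀ᶠ Z in (D : Filter {Z : Set ι // #Z < μ}), a ∈ Z.1) ∧ ∃ y, Tendsto f D (𝓝 y) := by
  classical
  let A : Finset ι → Set {Z : Set ι // #Z < μ} := fun F => {Z | (F : Set ι) ⊆ Z.1}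
  have hdir : Directed (· ≥ ·) A := fun F F' =>
    ⟨F ∪ F', fun _ hZ a ha => hZ (Finset.mem_union_left F' ha),
      fun _ hZ a ha => hZ (Finset.mem_union_right F ha)⟩
  have hbasis := hasBasis_iInf_principal hdir
  obtain ⟨y, hy⟩ := h.exists_clusterPt (mk_finset_le (hμ.trans hμν) hι) (hbasis.map f)
    (by
      intro J hJ
      refine ⟨f ⟨_, mk_biUnion_finset_lt hμ hJ⟩, Set.mem_iInter₂.2 fun F hF => ⟨_, ?_, rfl⟩⟩
      exact Set.subset_biUnion_of_mem (u := fun F : Finset ι => (F : Set ι)) hF)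
  obtain ⟨D, hD, hDy⟩ := mapClusterPt_iff_ultrafilter.1 hy
  refine ⟨D, fun a => hD ?_, y, hDy⟩
  exact mem_of_superset (hbasis.mem_of_mem (i := {a}) trivial) fun Z hZ => hZ (by simp)

/-- If `2^(ν^{<μ}) ≤ λ`, the product of a `[μ, ν]`-compact space with an initially
`λ`-compact space is `[μ, ν]`-compact. -/
theorem intervalCompact_prod (μ ν lam : Cardinal.{u})
    (hμ : Cardinal.aleph0 ≤ μ) (hμν : μ ≤ ν) (hlam : Cardinal.aleph0 ≤ lam)
    (h : (2 : Cardinal.{u}) ^ (ν ^< μ) ≤ lam)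
    (X₁ X₂ : Type u) [TopologicalSpace X₁] [TopologicalSpace X₂]
    (h₁ : IntervalCompact μ ν X₁) (h₂ : InitiallyCompact lam X₂) :
    IntervalCompact μ ν (X₁ × X₂) := by
  intro 𝒰 hopen hcover hcard
  by_contra! hno
  have hmiss : ∀ Z : {Z : Set 𝒰 // #Z < μ}, ∃ p : X₁ × X₂, ∀ U ∈ Z.1, p ∉ U.1 := by
    intro Z
    have hne := hno (Subtype.val '' Z.1) (Subtype.coe_image_subset _ _) (mk_image_le.trans_lt Z.2)
    obtain ⟨p, hp⟩ := (Set.ne_univ_iff_exists_notMem _).1 hne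
    exact ⟨p, fun U hU hpU => hp ⟨U, ⟨U, hU, rfl⟩, hpU⟩⟩
  choose p hp using hmiss
  obtain ⟨D, hD, y₁, hy₁⟩ := h₁.exists_ultrafilter_tendsto hμ hμν hcard fun Z => (p Z).1
  obtain ⟨y₂, hy₂⟩ := h₂.exists_tendsto
    ((power_le_power_left two_ne_zero (mk_subsets_lt_le_powerlt hμ hμν hcard)).trans h)
    D fun Z => (p Z).2
  obtain ⟨U, hU, hyU⟩ := hcover.symm ▸ Set.mem_univ (y₁, y₂)
  have hlim : Tendsto p D (𝓝 (y₁, y₂)) := hy₁.prodMk_nhds hy₂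
  obtain ⟨Z, hZU, hUZ⟩ := ((hlim.eventually_mem ((hopen U hU).mem_nhds hyU)).and (hD ⟨U, hU⟩)).exists
  exact hp Z _ hUZ hZU
end

section
/- Let μ ≤ ν be infinite cardinals such that every cardinal ρ with μ ≤ ρ ≤ ν is regular, and let λ be an infinite cardinal with 2^ν ≤ λ. If X₁ is a [μ,ν]-compact topological space and X₂ is an initially λ-compact topological space, then the product X₁ × X₂ is [μ,ν]-compact. -/
universe u

open Filter Topology Set in
/-- If `X` is initially `2 ^ #I`-compact, then every `I`-indexed family in `X` converges along
every ultrafilter on `I`. -/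
theorem InitiallyCompact.exists_tendsto_ultrafilter {lam : Cardinal.{u}} {X I : Type u}
    [TopologicalSpace X] (hX : InitiallyCompact lam X)
    (hI : (2 : Cardinal.{u}) ^ Cardinal.mk I ≤ lam) (D : Ultrafilter I) (y : I → X) :
    ∃ x, Tendsto y D (𝓝 x) := by
  by_contra! hy
  have hsep : ∀ x, ∃ U, IsOpen U ∧ x ∈ U ∧ y ⁻¹' U ∉ D := by
    intro x
    by_contra! hU
    refine hy x ((nhds_basis_opens x).tendsto_right_iff.2 fun U hxU ↦ ?_)
    exact hU U hxU.2 hxU.1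
  let V : {A : Set I // A ∉ D} → Set X := fun A ↦ ⋃₀ {U | IsOpen U ∧ y ⁻¹' U = A}
  have hV : ∀ A, y ⁻¹' V A ∉ D := by
    intro A hA
    refine A.2 (mem_of_superset hA ?_)
    rintro i ⟨U, ⟨-, hU⟩, hi⟩
    exact hU ▸ hi
  have hopen : ∀ U ∈ range V, IsOpen U := by
    rintro _ ⟨A, rfl⟩
    exact isOpen_sUnion fun U hU ↦ hU.1
  have huniv : ⋃₀ range V = univ := by
    refine eq_univ_of_forall fun x ↦ ?_
    obtain ⟨U, hU, hxU, hUD⟩ := hsep x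
    exact ⟨V ⟨_, hUD⟩, mem_range_self _, U, ⟨hU, rfl⟩, hxU⟩
  have hcard : Cardinal.mk (range V) ≤ lam := by
    calc Cardinal.mk (range V) ≤ Cardinal.mk {A : Set I // A ∉ D} := Cardinal.mk_range_le
      _ ≤ Cardinal.mk (Set I) := Cardinal.mk_subtype_le _
      _ = 2 ^ Cardinal.mk I := Cardinal.mk_set
      _ ≤ lam := hI
  obtain ⟨𝒱, h𝒱, hfin, hcov⟩ := hX (range V) hopen huniv hcard
  have hmem : ⋃₀ 𝒱 ∈ D.map y := hcov ▸ univ_mem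
  obtain ⟨W, hW, hWD⟩ := (Ultrafilter.finite_sUnion_mem_iff hfin).1 hmem
  obtain ⟨A, rfl⟩ := h𝒱 hW
  exact hV A hWD

open Filter Topology Set in
/-- In a `[μ, ν]`-compact space, every sequence whose length is a regular cardinal in `[μ, ν]`
has a cluster point. -/
theorem IntervalCompact.exists_mapClusterPt {μ ν κ : Cardinal.{u}} {X : Type u}
    [TopologicalSpace X] (hX : IntervalCompact μ ν X) (hμκ : μ ≤ κ) (hκν : κ ≤ ν)
    (hκ : κ.IsRegular) (x : κ.ord.ToType → X) : ∃ a, MapClusterPt a atTop x := by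
  by_contra! hx
  let G : κ.ord.ToType → Set X := fun i ↦ (closure (x '' Ici i))ᶜ
  have hG : Monotone G := fun i j hij ↦
    compl_subset_compl.2 (closure_mono (image_mono (Ici_subset_Ici.2 hij)))
  have : Nonempty κ.ord.ToType := by
    rw [← Cardinal.mk_ne_zero_iff, Cardinal.mk_ord_toType]
    exact hκ.ne_zero
  have hopen : ∀ U ∈ range G, IsOpen U := by
    rintro _ ⟨i, rfl⟩
    exact isClosed_closure.isOpen_compl
  have huniv : ⋃₀ range G = univ := by
    refine eq_univ_of_forall fun a ↦ ?_
    by_contra ha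
    refine hx a (mapClusterPt_iff_frequently.2 fun s hs ↦ frequently_atTop.2 fun i ↦ ?_)
    have hai : a ∈ closure (x '' Ici i) := by
      by_contra hai
      exact ha ⟨G i, mem_range_self i, hai⟩
    obtain ⟨_, hbs, j, hj, rfl⟩ := mem_closure_iff_nhds.1 hai s hs
    exact ⟨j, hj, hbs⟩
  have hle : Cardinal.mk (range G) ≤ ν := by
    exact Cardinal.mk_range_le.trans ((Cardinal.mk_ord_toType κ).trans_le hκν)
  obtain ⟨𝒱, h𝒱, hcard, hcov⟩ := hX (range G) hopen huniv hle
  choose! f hf using h𝒱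
  have hnc : ¬ IsCofinal (f '' 𝒱) := by
    intro hc
    have hle := Order.cof_le hc
    rw [Ordinal.cof_toType, hκ.cof_ord] at hle
    exact (hle.trans Cardinal.mk_image_le).not_gt (hcard.trans_le hμκ)
  obtain ⟨i, hi⟩ := not_isCofinal_iff.1 hnc
  obtain ⟨W, hW, hxW⟩ : x i ∈ ⋃₀ 𝒱 := hcov ▸ mem_univ _
  rw [← hf hW] at hxW
  exact hG (hi _ (mem_image_of_mem f hW)).le hxW
    (subset_closure (mem_image_of_mem x self_mem_Ici))

open Filter Topology Set in
/-- If every cardinal in `[μ, ν]` is regular and `2^ν ≤ λ`, the product of a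
`[μ, ν]`-compact space with an initially `λ`-compact space is `[μ, ν]`-compact. -/
theorem intervalCompact_prod_of_regular_interval (μ ν lam : Cardinal.{u})
    (hμ : Cardinal.aleph0 ≤ μ) (hμν : μ ≤ ν) (hlam : Cardinal.aleph0 ≤ lam)
    (hreg : ∀ ρ : Cardinal.{u}, μ ≤ ρ → ρ ≤ ν → ρ.IsRegular)
    (h : (2 : Cardinal.{u}) ^ ν ≤ lam)
    (X₁ X₂ : Type u) [TopologicalSpace X₁] [TopologicalSpace X₂]
    (h₁ : IntervalCompact μ ν X₁) (h₂ : InitiallyCompact lam X₂) :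
    IntervalCompact μ ν (X₁ × X₂) := by
  intro 𝒰 hopen hcov hcard
  obtain ⟨𝒱, ⟨h𝒱, h𝒱cov⟩, hmin⟩ :=
    (InvImage.wf (fun 𝒱 : Set (Set (X₁ × X₂)) ↦ Cardinal.mk 𝒱) Cardinal.lt_wf).has_min
      {𝒱 | 𝒱 ⊆ 𝒰 ∧ ⋃₀ 𝒱 = univ} ⟨𝒰, Subset.rfl, hcov⟩
  refine ⟨𝒱, h𝒱, ?_, h𝒱cov⟩
  by_contra! hμκ
  obtain ⟨κ, hκ⟩ : ∃ κ, κ = Cardinal.mk 𝒱 := ⟨_, rfl⟩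
  rw [← hκ] at hμκ
  have hκν : κ ≤ ν := hκ.trans_le ((Cardinal.mk_le_mk_of_subset h𝒱).trans hcard)
  have hκreg := hreg κ hμκ hκν
  have : NoMaxOrder κ.ord.ToType := Cardinal.noMaxOrder hκreg.aleph0_le
  have : Nonempty κ.ord.ToType := by
    rw [← Cardinal.mk_ne_zero_iff, Cardinal.mk_ord_toType]
    exact hκreg.ne_zero
  obtain ⟨e⟩ := Cardinal.eq.1 ((Cardinal.mk_ord_toType κ).trans hκ)
  have hmiss : ∀ i, ∃ p, ∀ j < i, p ∉ (e j : Set (X₁ × X₂)) := by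
    intro i
    by_contra! hi
    refine hmin ((fun j ↦ (e j : Set (X₁ × X₂))) '' Iio i) ⟨?_, ?_⟩ ?_
    · rintro _ ⟨j, -, rfl⟩
      exact h𝒱 (e j).2
    · refine eq_univ_of_forall fun p ↦ ?_
      obtain ⟨j, hj, hp⟩ := hi p
      exact ⟨_, mem_image_of_mem _ hj, hp⟩
    · have hlt : Cardinal.mk (Iio i) < κ := by
        simpa using Cardinal.mk_Iio_lt i (by simp)
      exact Cardinal.mk_image_le.trans_lt (hlt.trans_eq hκ)
  choose p hp using hmiss
  obtain ⟨a, ha⟩ := h₁.exists_mapClusterPt hμκ hκν hκreg fun i ↦ (p i).1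
  obtain ⟨D, hD, hDa⟩ := mapClusterPt_iff_ultrafilter.1 ha
  have hpow : (2 : Cardinal.{u}) ^ Cardinal.mk κ.ord.ToType ≤ lam := by
    rw [Cardinal.mk_ord_toType]
    exact (Cardinal.power_le_power_left two_ne_zero hκν).trans h
  obtain ⟨b, hDb⟩ := h₂.exists_tendsto_ultrafilter hpow D fun i ↦ (p i).2
  obtain ⟨W, hW, habW⟩ : (a, b) ∈ ⋃₀ 𝒱 := h𝒱cov ▸ mem_univ _
  have hlim : Tendsto p D (𝓝 (a, b)) := hDa.prodMk_nhds hDb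
  have hev := hlim.eventually ((hopen W (h𝒱 hW)).mem_nhds habW)
  obtain ⟨i, hiW, hi⟩ := (hev.and (hD (eventually_gt_atTop (e.symm ⟨W, hW⟩)))).exists
  exact hp i _ hi (by rwa [e.apply_symm_apply])
end

section
/- Let (X_j)_{j∈J} be a family of nonempty topological spaces. If the product space ∏_{j∈J} X_j is sequentially compact, then the set of indices j ∈ J such that X_j contains a sequence converging to no point of X_j has cardinality strictly less than the splitting number 𝔰. -/
universe u

/-- The splitting number `𝔰`: the least cardinality of a family `S` of infinite subsets
of `ℕ` such that every infinite `A ⊆ ℕ` is split by some member of `S`. -/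
noncomputable def splittingNumber : Cardinal.{0} :=
  sInf {c : Cardinal.{0} | ∃ S : Set (Set ℕ), Cardinal.mk S = c ∧
    (∀ s ∈ S, s.Infinite) ∧
    ∀ A : Set ℕ, A.Infinite → ∃ s ∈ S, (A ∩ s).Infinite ∧ (A \ s).Infinite}

/-- In a sequentially compact space, if any two points have a common specialization then every
sequence converges. -/
theorem exists_tendsto_of_forall_exists_specializes {Y : Type*} [TopologicalSpace Y]
    [SeqCompactSpace Y] (hY : ∀ a b : Y, ∃ p, a ⤳ p ∧ b ⤳ p) (v : ℕ → Y) :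
    ∃ p, Filter.Tendsto v Filter.atTop (nhds p) := by
  choose c hc₁ hc₂ using hY
  let w : ℕ → Y := fun n => Nat.rec (v 0) (fun k z => c z (v (k + 1))) n
  have hvw : ∀ i n, i ≤ n → v i ⤳ w n := by
    intro i n hin
    induction n with
    | zero =>
      obtain rfl : i = 0 := by omega
      exact specializes_rfl
    | succ n ih =>
      rcases Nat.le_succ_iff.1 hin with hin | rfl
      · exact (ih hin).trans (hc₁ _ _)
      · exact hc₂ _ _
  obtain ⟨q, φ, hφ, hq⟩ := SeqCompactSpace.tendsto_subseq w
  have hvq : ∀ i, v i ⤳ q := fun i => specializes_iff_forall_open.2 fun U hU hqU => by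
    obtain ⟨k, hkU, hik⟩ :=
      ((hq.eventually_mem (hU.mem_nhds hqU)).and (Filter.eventually_ge_atTop i)).exists
    exact (hvw i (φ k) (hik.trans (hφ.id_le k))).mem_open hU hkU
  exact ⟨q, fun U hU => Filter.mem_map.2 <| Filter.univ_mem' fun i =>
    show v i ∈ U from mem_of_mem_nhds ((hvq i).nhds_le_nhds hU)⟩

/-- If a subsequence of `y` converges to `p` and takes the value `a` along infinitely many
indices, then `p` lies in the closure of `{a}`. -/
theorem specializes_of_tendsto_of_infinite {Y : Type*} [TopologicalSpace Y] {y : ℕ → Y}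
    {φ : ℕ → ℕ} {p a : Y} {A : Set ℕ} (hp : Filter.Tendsto (y ∘ φ) Filter.atTop (nhds p))
    (hA : (Set.range φ ∩ A).Infinite) (hy : ∀ n ∈ Set.range φ ∩ A, y n = a) : a ⤳ p := by
  refine specializes_iff_forall_open.2 fun U hU hpU => ?_
  obtain ⟨N, hN⟩ := Filter.eventually_atTop.1 (hp.eventually_mem (hU.mem_nhds hpU))
  obtain ⟨_, ⟨⟨k, rfl⟩, hkA⟩, hk⟩ := (hA.sdiff ((Set.finite_lt_nat N).image φ)).nonempty
  have hNk : N ≤ k := by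
    by_contra! hlt
    exact hk ⟨k, hlt, rfl⟩
  rw [← hy (φ k) ⟨⟨k, rfl⟩, hkA⟩]
  exact hN k hNk

/-- Each factor of a sequentially compact product of nonempty spaces is sequentially compact. -/
theorem seqCompactSpace_of_pi {J : Type*} (X : J → Type*) [∀ j, TopologicalSpace (X j)]
    [∀ j, Nonempty (X j)] [SeqCompactSpace (Π j, X j)] (j : J) : SeqCompactSpace (X j) := by
  have hr := IsSeqCompact.range (continuous_apply (A := X) j).seqContinuous
  rw [(Function.surjective_eval j).range_eq] at hr
  exact ⟨hr⟩

/-- The splitting number is attained by a splitting family. -/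
theorem exists_splitting_family_card_eq : ∃ S : Set (Set ℕ),
    Cardinal.mk S = splittingNumber ∧ (∀ s ∈ S, s.Infinite) ∧
      ∀ A : Set ℕ, A.Infinite → ∃ s ∈ S, (A ∩ s).Infinite ∧ (A \ s).Infinite := by
  refine csInf_mem (s := {c : Cardinal.{0} | ∃ S : Set (Set ℕ), Cardinal.mk S = c ∧
    (∀ s ∈ S, s.Infinite) ∧
    ∀ A : Set ℕ, A.Infinite → ∃ s ∈ S, (A ∩ s).Infinite ∧ (A \ s).Infinite})
    ⟨_, {s | s.Infinite}, rfl, fun _ hs => hs, fun A hA => ?_⟩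
  obtain ⟨t, u, rfl, hd, htu⟩ := hA.exists_union_disjoint_cardinal_eq_of_infinite
  have hiff : t.Infinite ↔ u.Infinite := by
    rw [← Set.infinite_coe_iff, ← Set.infinite_coe_iff, Cardinal.infinite_iff,
      Cardinal.infinite_iff, htu]
  have ht : t.Infinite := (Set.infinite_union.1 hA).elim id hiff.2
  refine ⟨t, ht, ?_, ?_⟩
  · rwa [Set.union_inter_cancel_left]
  · rw [Set.union_sdiff_left, hd.symm.sdiff_eq_left]
    exact hiff.1 ht

/-- If a product of nonempty spaces is sequentially compact, then fewer than `𝔰` of the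
factors contain a sequence converging to no point. -/
theorem card_nonconverging_lt_splittingNumber {J : Type u} (X : J → Type u)
    [∀ j, TopologicalSpace (X j)] [∀ j, Nonempty (X j)]
    (h : SeqCompactSpace (Π j, X j)) :
    Cardinal.mk {j : J | ∃ u : ℕ → X j, ∀ p : X j,
        ¬ Filter.Tendsto u Filter.atTop (nhds p)} <
      Cardinal.lift.{u} splittingNumber := by
  obtain ⟨S, hScard, -, hS⟩ := exists_splitting_family_card_eq
  rw [← hScard]
  by_contra! hle
  rw [← Cardinal.lift_id'.{0, u} (Cardinal.mk {j : J | _}), Cardinal.lift_mk_le'] at hle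
  obtain ⟨e⟩ := hle
  have hseq : ∀ j : J, ∃ y : ℕ → X j, ∀ s : S, (e s : J) = j →
      ∀ φ : ℕ → ℕ, (Set.range φ ∩ s).Infinite → (Set.range φ \ s).Infinite →
        ∀ p, ¬ Filter.Tendsto (y ∘ φ) Filter.atTop (nhds p) := by
    intro j
    by_cases hj : ∃ s : S, (e s : J) = j
    · obtain ⟨s, rfl⟩ := hj
      obtain ⟨v, hv⟩ := (e s).2
      have := seqCompactSpace_of_pi X (e s : J)
      obtain ⟨a, b, hab⟩ : ∃ a b : X (e s), ∀ p, ¬ (a ⤳ p ∧ b ⤳ p) := by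
        by_contra! H
        obtain ⟨p, hp⟩ := exists_tendsto_of_forall_exists_specializes H v
        exact hv p hp
      classical
      refine ⟨fun n => if n ∈ (s : Set ℕ) then a else b, fun s' hs' φ hφ hφ' p hp => ?_⟩
      obtain rfl : s' = s := e.injective (Subtype.ext hs')
      refine hab p ⟨specializes_of_tendsto_of_infinite hp hφ fun n hn => ?_,
        specializes_of_tendsto_of_infinite hp (A := (s' : Set ℕ)ᶜ) hφ' fun n hn => ?_⟩
      · exact if_pos hn.2
      · exact if_neg hn.2
    · exact ⟨fun _ => Classical.arbitrary _, fun s hs => absurd ⟨s, hs⟩ hj⟩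
  choose y hy using hseq
  obtain ⟨p, φ, hφ, hp⟩ := SeqCompactSpace.tendsto_subseq fun n j => y j n
  obtain ⟨s, hs, h₁, h₂⟩ := hS (Set.range φ) (Set.infinite_range_of_injective hφ.injective)
  exact hy _ ⟨s, hs⟩ rfl φ h₁ h₂ _ (tendsto_pi_nhds.1 hp _)
end

section
/- The cofinality of the splitting number 𝔰 is at least 𝔥, i.e., cf(𝔰) ≥ 𝔥. -/
/-- The cardinal `𝔥`: the smallest cardinality of a family of sequentially compact
nonempty topological spaces whose product is not sequentially compact. -/
noncomputable def hCardinal : Cardinal.{0} :=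
  sInf {c : Cardinal.{0} | ∃ (J : Type) (X : J → Type)
    (_ : ∀ j, TopologicalSpace (X j)), Cardinal.mk J = c ∧
    (∀ j, Nonempty (X j)) ∧ (∀ j, SeqCompactSpace (X j)) ∧
    ¬ SeqCompactSpace (Π j, X j)}

open Cardinal Filter Topology

/-- The splitting number is the cardinality of some splitting family. -/
theorem exists_splitting_family_mk_eq_splittingNumber :
    ∃ S : Set (Set ℕ), #S = splittingNumber ∧
      ∀ A : Set ℕ, A.Infinite → ∃ s ∈ S, (A ∩ s).Infinite ∧ (A \ s).Infinite := by
  have key : splittingNumber ∈ {c : Cardinal.{0} | ∃ S : Set (Set ℕ), #S = c ∧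
      (∀ s ∈ S, s.Infinite) ∧
      ∀ A : Set ℕ, A.Infinite → ∃ s ∈ S, (A ∩ s).Infinite ∧ (A \ s).Infinite} := by
    refine csInf_mem ⟨_, {s | s.Infinite}, rfl, fun _ hs => hs, fun A hA => ?_⟩
    classical
    have := hA.to_subtype
    set g := Nat.orderEmbeddingOfSet A
    have hgA (n : ℕ) : g n ∈ A := Nat.orderEmbeddingOfSet_range A ▸ Set.mem_range_self n
    have even_sub : Set.range (fun n => g (2 * n)) ⊆ A ∩ Set.range (fun n => g (2 * n)) := by
      rintro _ ⟨n, rfl⟩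
      exact ⟨hgA _, n, rfl⟩
    have odd_sub : Set.range (fun n => g (2 * n + 1)) ⊆ A \ Set.range (fun n => g (2 * n)) := by
      rintro _ ⟨n, rfl⟩
      refine ⟨hgA _, ?_⟩
      rintro ⟨m, hm⟩
      have := g.injective hm
      omega
    have even_inf : (Set.range (fun n => g (2 * n))).Infinite :=
      Set.infinite_range_of_injective fun a b h => by have := g.injective h; omega
    have odd_inf : (Set.range (fun n => g (2 * n + 1))).Infinite :=
      Set.infinite_range_of_injective fun a b h => by have := g.injective h; omega
    exact ⟨_, even_inf, even_inf.mono even_sub, odd_inf.mono odd_sub⟩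
  obtain ⟨S, hS, -, h⟩ := key
  exact ⟨S, hS, h⟩

/-- A family of fewer than `𝔰` subsets of `ℕ` leaves some infinite set unsplit. -/
theorem exists_infinite_unsplit_of_mk_lt_splittingNumber {T : Type} (hT : #T < splittingNumber)
    (f : T → Set ℕ) :
    ∃ A : Set ℕ, A.Infinite ∧ ∀ t, (A ∩ f t).Finite ∨ (A \ f t).Finite := by
  by_contra! H
  have hle : splittingNumber ≤ #(Set.range f ∩ {s | s.Infinite} : Set (Set ℕ)) := by
    refine csInf_le' ⟨_, rfl, fun s hs => hs.2, fun A hA => ?_⟩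
    obtain ⟨t, h_in, h_out⟩ := H A hA
    exact ⟨f t, ⟨⟨t, rfl⟩, h_in.mono Set.inter_subset_right⟩, h_in, h_out⟩
  exact (hle.trans ((mk_le_mk_of_subset Set.inter_subset_left).trans mk_range_le)).not_gt hT

/-- A product of fewer than `𝔰` copies of `Bool` is sequentially compact. -/
theorem seqCompactSpace_pi_bool_of_mk_lt_splittingNumber {T : Type} (hT : #T < splittingNumber) :
    SeqCompactSpace (T → Bool) := by
  refine ⟨fun x _ => ?_⟩
  obtain ⟨A, hA, hsplit⟩ :=
    exists_infinite_unsplit_of_mk_lt_splittingNumber hT fun t => {n | x n t = true}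
  classical
  have := hA.to_subtype
  set g := Nat.orderEmbeddingOfSet A
  have hgA (n : ℕ) : g n ∈ A := Nat.orderEmbeddingOfSet_range A ▸ Set.mem_range_self n
  have eventually_notMem {F : Set ℕ} (hF : F.Finite) : ∀ᶠ n in atTop, g n ∉ F := by
    have := g.injective.tendsto_cofinite.eventually hF.compl_mem_cofinite
    rwa [Nat.cofinite_eq_atTop] at this
  have conv (t : T) : ∃ b : Bool, ∀ᶠ n in atTop, x (g n) t = b := by
    rcases hsplit t with h | h
    · refine ⟨false, (eventually_notMem h).mono fun n hn => ?_⟩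
      simpa [hgA n] using hn
    · refine ⟨true, (eventually_notMem h).mono fun n hn => ?_⟩
      simpa [hgA n] using hn
  choose a ha using conv
  refine ⟨a, Set.mem_univ _, g, g.strictMono, tendsto_pi_nhds.2 fun t => ?_⟩
  exact tendsto_const_nhds.congr' ((ha t).mono fun n hn => hn.symm)

/-- If the sets `f j t` split every infinite subset of `ℕ`, then the product of the powers
`T j → Bool` is not sequentially compact. -/
theorem not_seqCompactSpace_pi_of_splitting {J : Type*} {T : J → Type*} (f : ∀ j, T j → Set ℕ)
    (hf : ∀ A : Set ℕ, A.Infinite → ∃ j t, (A ∩ f j t).Infinite ∧ (A \ f j t).Infinite) :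
    ¬ SeqCompactSpace (∀ j, T j → Bool) := by
  classical
  intro h
  obtain ⟨a, -, φ, hφ, hlim⟩ :=
    h.isSeqCompact_univ (x := fun n j t => decide (n ∈ f j t)) fun _ => Set.mem_univ _
  obtain ⟨j, t, h_in, h_out⟩ := hf _ (Set.infinite_range_of_injective hφ.injective)
  have ht := tendsto_pi_nhds.1 (tendsto_pi_nhds.1 hlim j) t
  rw [nhds_discrete, tendsto_pure, eventually_atTop] at ht
  obtain ⟨N, hN⟩ := ht
  have fin : (φ '' Set.Iio N).Finite := (Set.finite_Iio N).image φ
  cases hb : a j t with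
  | true =>
    refine h_out (fin.subset ?_)
    rintro _ ⟨⟨n, rfl⟩, hn⟩
    refine ⟨n, ?_, rfl⟩
    by_contra hle
    exact hn (by simpa [hb] using hN n (not_lt.1 hle))
  | false =>
    refine h_in (fin.subset ?_)
    rintro _ ⟨⟨n, rfl⟩, hn⟩
    refine ⟨n, ?_, rfl⟩
    by_contra hle
    have := hN n (not_lt.1 hle)
    simp [hb, hn] at this

/-- A power of `Bool` indexed by a closed initial segment of `𝔰` is sequentially compact. -/
theorem seqCompactSpace_pi_Iic_splittingNumber (i : splittingNumber.ord.ToType) :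
    SeqCompactSpace (Set.Iic i → Bool) := by
  have hIio : #(Set.Iio i) < splittingNumber := by
    simpa using mk_Iio_lt i (by simp)
  rcases lt_or_ge splittingNumber ℵ₀ with hfin | hinf
  · have : Countable (Set.Iic i) :=
      mk_le_aleph0_iff.1 <| (mk_set_le _).trans <| by simpa using hfin.le
    infer_instance
  · refine seqCompactSpace_pi_bool_of_mk_lt_splittingNumber ?_
    rw [← Set.Iio_insert]
    exact mk_insert_le.trans_lt (add_lt_of_lt hinf hIio (one_lt_aleph0.trans_le hinf))

/-- The cofinality of the splitting number is at least `𝔥`. -/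
theorem hCardinal_le_cof_splittingNumber : hCardinal ≤ splittingNumber.ord.cof := by
  obtain ⟨S, hS, hsplit⟩ := exists_splitting_family_mk_eq_splittingNumber
  obtain ⟨e⟩ : Nonempty (splittingNumber.ord.ToType ≃ S) := Cardinal.eq.1 (by simp [hS])
  obtain ⟨J, hJ, hcard⟩ := Order.exists_cof_eq splittingNumber.ord.ToType
  rw [Ordinal.cof_toType] at hcard
  refine csInf_le' ⟨J, fun j => Set.Iic j.1 → Bool, inferInstance, hcard, fun _ => inferInstance,
    fun j => seqCompactSpace_pi_Iic_splittingNumber j.1,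
    not_seqCompactSpace_pi_of_splitting (fun _ i => (e i.1 : Set ℕ)) fun A hA => ?_⟩
  obtain ⟨s, hs, h⟩ := hsplit A hA
  obtain ⟨j, hj, hle⟩ := hJ (e.symm ⟨s, hs⟩)
  exact ⟨⟨j, hj⟩, ⟨_, hle⟩, by simpa using h⟩
end
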